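/- arXiv:2507.22230 — 4 statements merged into one kernel-verified Lean document; each statement's English description precedes it below -/
import Mathlib

section
/- Let (Y, ⪯, id, □, ⁻¹) be an ore and let G ⊆ Y be its set of admissible elements. Then (G, ⋆) is a group with identity id, in which the inverse of each g ∈ G is g⁻¹. -/
noncomputable section

/-- The data of an ore together with axioms (O1), (O2) and (O3): a partial order `le`
with binary meets and bottom element `idY` (O1), a cancellative monoid structure `op`
with identity `idY` and involution `inv` (O2), such that `le x y` holds iff `y = op x z`
for some `z` (O3). -/
structure OreData (Y : Type) where
  le : Y → Y → Prop
  idY : Y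
  op : Y → Y → Y
  inv : Y → Y
  meet : Y → Y → Y
  le_refl : ∀ x, le x x
  le_antisymm : ∀ x y, le x y → le y x → x = y
  le_trans : ∀ x y z, le x y → le y z → le x z
  meet_le_left : ∀ x y, le (meet x y) x
  meet_le_right : ∀ x y, le (meet x y) y
  le_meet : ∀ x y z, le z x → le z y → le z (meet x y)
  id_le : ∀ x, le idY x
  op_assoc : ∀ x y z, op (op x y) z = op x (op y z)
  op_id : ∀ x, op x idY = x
  id_op : ∀ x, op idY x = x
  cancel_left : ∀ x y z, op x y = op x z → y = z
  cancel_right : ∀ x y z, op x z = op y z → x = y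
  inv_invol : ∀ x, inv (inv x) = x
  inv_op : ∀ x y, inv (op x y) = op (inv y) (inv x)
  le_iff : ∀ x y, le x y ↔ ∃ z, y = op x z

namespace OreData

variable {Y : Type} (O : OreData Y)

/-- An element is admissible if it is not of the form `x □ y □ y⁻¹ □ z` with `y ≠ id`. -/
def Admissible (f : Y) : Prop :=
  ¬ ∃ x y z : Y, y ≠ O.idY ∧ f = O.op (O.op (O.op x y) (O.inv y)) z

/-- `j` is the least upper bound of `x` and `y`. -/
def IsJoin (x y j : Y) : Prop :=
  O.le x j ∧ O.le y j ∧ ∀ s, O.le x s → O.le y s → O.le j s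

/-- `j` is the least upper bound of `x`, `y`, `z`. -/
def IsJoin3 (x y z j : Y) : Prop :=
  O.le x j ∧ O.le y j ∧ O.le z j ∧ ∀ s, O.le x s → O.le y s → O.le z s → O.le j s

/-- `j` is the least upper bound of `x`, `y`, `z` within the admissible elements. -/
def IsJoin3G (x y z j : Y) : Prop :=
  O.Admissible j ∧ O.le x j ∧ O.le y j ∧ O.le z j ∧
    ∀ s, O.Admissible s → O.le x s → O.le y s → O.le z s → O.le j s

/-- `x` and `y` are orthogonal: their meet is `id` and their join exists. -/
def Orth (x y : Y) : Prop := O.meet x y = O.idY ∧ ∃ j, O.IsJoin x y j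

/-- Axiom (O4): the admissible elements form a median semilattice. -/
def O4 : Prop :=
  ∀ a b c : Y, O.Admissible a → O.Admissible b → O.Admissible c →
    ∃ m : Y, O.IsJoin3G (O.meet a b) (O.meet b c) (O.meet a c) m ∧
      ∀ x : Y, O.Admissible x →
        O.IsJoin3G (O.meet x (O.meet a b)) (O.meet x (O.meet b c))
          (O.meet x (O.meet a c)) (O.meet x m)

/-- Axiom (O5). -/
def O5 : Prop :=
  ∀ x y y' : Y, O.Orth x y → O.Admissible x → O.Admissible y' →
    O.IsJoin x y (O.op x y') → O.Admissible y

/-- Axiom (O6). -/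
def O6 : Prop :=
  ∀ x y x' y' : Y, O.Admissible x → O.Admissible y → O.Orth x y →
    O.IsJoin x y (O.op x y') → O.IsJoin x y (O.op y x') →
    O.Admissible x' ∧ O.Admissible y' ∧
    O.Orth (O.inv x) y' ∧ O.Orth (O.inv y) x' ∧
    O.IsJoin (O.inv x) y' (O.op (O.inv x) y) ∧
    O.op (O.inv x) y = O.op y' (O.inv x') ∧
    O.IsJoin (O.inv y) x' (O.inv (O.op (O.inv x) y))

/-- `(Y, ⪯, id, □, ⁻¹)` is an ore: axioms (O1)–(O3) hold by the `OreData` structure and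
axioms (O4)–(O6) hold as well. -/
def IsOre : Prop := O.O4 ∧ O.O5 ∧ O.O6

open Classical in
/-- `y ∹ x`: the unique `z` with `y = x □ z` (if it exists; junk value otherwise). -/
def rdiv (y x : Y) : Y :=
  if h : ∃ z, y = O.op x z then h.choose else O.idY

open Classical in
/-- `y ∸ z`: the unique `x` with `y = x □ z` (if it exists; junk value otherwise). -/
def ldiv (y z : Y) : Y :=
  if h : ∃ x, y = O.op x z then h.choose else O.idY

/-- The star product `f ⋆ g = (f ∸ (f⁻¹ ∧ g)⁻¹) □ (g ∹ (f⁻¹ ∧ g))`. -/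
def star (f g : Y) : Y :=
  O.op (O.ldiv f (O.inv (O.meet (O.inv f) g))) (O.rdiv g (O.meet (O.inv f) g))

end OreData

namespace OreData

variable {Y : Type} (O : OreData Y)

theorem le_op (x z : Y) : O.le x (O.op x z) := (O.le_iff _ _).2 ⟨z, rfl⟩

theorem inv_id : O.inv O.idY = O.idY := by
  have h := O.inv_op (O.inv O.idY) O.idY
  rw [O.op_id, O.inv_invol, O.op_id] at h
  exact h.symm

theorem inv_eq_id {x : Y} (h : O.inv x = O.idY) : x = O.idY := by
  rw [← O.inv_invol x, h, O.inv_id]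

theorem le_id {x : Y} (h : O.le x O.idY) : x = O.idY := O.le_antisymm _ _ h (O.id_le x)

theorem op_le_op_iff {c x y : Y} : O.le (O.op c x) (O.op c y) ↔ O.le x y := by
  rw [O.le_iff, O.le_iff]
  constructor
  · rintro ⟨z, hz⟩
    exact ⟨z, O.cancel_left c _ _ (by rw [hz, O.op_assoc])⟩
  · rintro ⟨z, rfl⟩
    exact ⟨z, (O.op_assoc _ _ _).symm⟩

theorem meet_comm (x y : Y) : O.meet x y = O.meet y x :=
  O.le_antisymm _ _ (O.le_meet _ _ _ (O.meet_le_right _ _) (O.meet_le_left _ _))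
    (O.le_meet _ _ _ (O.meet_le_right _ _) (O.meet_le_left _ _))

theorem meet_eq_id_of_le {x x' y y' : Y} (h : O.meet x y = O.idY) (hx : O.le x' x)
    (hy : O.le y' y) : O.meet x' y' = O.idY := by
  apply O.le_id
  rw [← h]
  exact O.le_meet _ _ _ (O.le_trans _ _ _ (O.meet_le_left _ _) hx)
    (O.le_trans _ _ _ (O.meet_le_right _ _) hy)

theorem eq_id_of_meet {x y z : Y} (h : O.meet x y = O.idY) (hx : O.le z x)
    (hy : O.le z y) : z = O.idY :=
  O.le_id (h ▸ O.le_meet _ _ _ hx hy)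

theorem meet_eq_id_iff {x y : Y} :
    O.meet x y = O.idY ↔ ∀ z, O.le z x → O.le z y → z = O.idY :=
  ⟨fun h _ => O.eq_id_of_meet h,
    fun h => h _ (O.meet_le_left _ _) (O.meet_le_right _ _)⟩

/-- Left multiplication preserves meets. -/
theorem op_meet (c x y : Y) : O.meet (O.op c x) (O.op c y) = O.op c (O.meet x y) := by
  apply O.le_antisymm
  · obtain ⟨z, hz⟩ := (O.le_iff _ _).1
      (O.le_meet _ _ c (O.le_op c x) (O.le_op c y))
    have hl := O.meet_le_left (O.op c x) (O.op c y)
    have hr := O.meet_le_right (O.op c x) (O.op c y)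
    rw [hz, op_le_op_iff] at hl hr
    rw [hz, op_le_op_iff]
    exact O.le_meet _ _ _ hl hr
  · exact O.le_meet _ _ _ (O.op_le_op_iff.2 (O.meet_le_left _ _))
      (O.op_le_op_iff.2 (O.meet_le_right _ _))

/-- Two elements factor through their meet with coprime remainders. -/
theorem exists_meet_factor (x y : Y) : ∃ d x' y', O.meet x y = d ∧ x = O.op d x' ∧
    y = O.op d y' ∧ O.meet x' y' = O.idY := by
  obtain ⟨x', hx⟩ := (O.le_iff _ _).1 (O.meet_le_left x y)
  obtain ⟨y', hy⟩ := (O.le_iff _ _).1 (O.meet_le_right x y)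
  refine ⟨_, x', y', rfl, hx, hy, ?_⟩
  apply O.cancel_left (O.meet x y)
  rw [← O.op_meet, ← hx, ← hy, O.op_id]

/-- `Square x y x' y'` says that `x ⊥ y`, with `x ∨ y = x □ y' = y □ x'`. -/
def Square (x y x' y' : Y) : Prop :=
  O.meet x y = O.idY ∧ O.op x y' = O.op y x' ∧ O.IsJoin x y (O.op x y')

variable {O}

theorem Square.symm {x y x' y' : Y} (h : O.Square x y x' y') : O.Square y x y' x' := by
  obtain ⟨h1, h2, h3, h4, h5⟩ := h
  refine ⟨by rw [O.meet_comm, h1], h2.symm, ?_⟩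
  rw [← h2]
  exact ⟨h4, h3, fun s hs hs' => h5 s hs' hs⟩

theorem Square.le {x y x' y' s : Y} (h : O.Square x y x' y') (hx : O.le x s)
    (hy : O.le y s) : O.le (O.op x y') s := h.2.2.2.2 s hx hy

theorem Square.eq_id_of_right {x y x' y' : Y} (h : O.Square x y x' y')
    (hy : y' = O.idY) : y = O.idY := by
  obtain ⟨h1, h2, -⟩ := h
  rw [hy, O.op_id] at h2
  exact O.eq_id_of_meet h1 (h2 ▸ O.le_op _ _) (O.le_refl _)

variable (O)

/-- Coprime elements with a common upper bound are orthogonal. -/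
theorem exists_square {x y s : Y} (h : O.meet x y = O.idY) (hx : O.le x s) (hy : O.le y s) :
    ∃ x' y', O.Square x y x' y' := by
  obtain ⟨y₀, rfl⟩ := (O.le_iff _ _).1 hx
  obtain ⟨x₀, hs⟩ := (O.le_iff _ _).1 hy
  obtain ⟨u, r, t, -, hr, ht, hrt⟩ := O.exists_meet_factor (O.inv y₀) (O.inv x₀)
  have hy₀ : y₀ = O.op (O.inv r) (O.inv u) := by rw [← O.inv_op, ← hr, O.inv_invol]
  have hx₀ : x₀ = O.op (O.inv t) (O.inv u) := by rw [← O.inv_op, ← ht, O.inv_invol]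
  have heq : O.op x (O.inv r) = O.op y (O.inv t) := by
    apply O.cancel_right _ _ (O.inv u)
    rw [O.op_assoc, O.op_assoc, ← hx₀, ← hy₀, hs]
  refine ⟨O.inv t, O.inv r, h, heq, O.le_op _ _, heq ▸ O.le_op _ _, fun k hxk hyk => ?_⟩
  have hxm := O.le_meet _ _ _ hxk (O.le_op x (O.inv r))
  have hym := O.le_meet _ _ _ hyk (heq ▸ O.le_op y (O.inv t))
  obtain ⟨α, hα⟩ := (O.le_iff _ _).1 hxm
  obtain ⟨β, hβ⟩ := (O.le_iff _ _).1 hym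
  obtain ⟨c, hc⟩ := (O.le_iff _ _).1 (O.meet_le_right k (O.op x (O.inv r)))
  have h1 : O.inv r = O.op α c := by
    apply O.cancel_left x
    rw [← O.op_assoc, ← hα, ← hc]
  have h2 : O.inv t = O.op β c := by
    apply O.cancel_left y
    rw [← O.op_assoc, ← hβ, ← hc, heq]
  have h1' : r = O.op (O.inv c) (O.inv α) := by rw [← O.inv_op, ← h1, O.inv_invol]
  have h2' : t = O.op (O.inv c) (O.inv β) := by rw [← O.inv_op, ← h2, O.inv_invol]
  have hcid : c = O.idY := O.inv_eq_id
    (O.eq_id_of_meet hrt (h1' ▸ O.le_op _ _) (h2' ▸ O.le_op _ _))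
  rw [hc, hcid, O.op_id]
  exact O.meet_le_left _ _

variable {O}

theorem Admissible.inv {f : Y} (h : O.Admissible f) : O.Admissible (O.inv f) := by
  rintro ⟨x, y, z, hy, hf⟩
  refine h ⟨O.inv z, y, O.inv x, hy, ?_⟩
  rw [← O.inv_invol f, hf]
  simp only [O.inv_op, O.inv_invol, O.op_assoc]

theorem Admissible.left {x y : Y} (h : O.Admissible (O.op x y)) : O.Admissible x := by
  rintro ⟨p, q, r, hq, rfl⟩
  exact h ⟨p, q, O.op r y, hq, O.op_assoc _ _ _⟩

theorem Admissible.right {x y : Y} (h : O.Admissible (O.op x y)) : O.Admissible y := by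
  rintro ⟨p, q, r, hq, rfl⟩
  exact h ⟨O.op x p, q, r, hq, by simp only [O.op_assoc]⟩

theorem Admissible.of_le {x y : Y} (h : O.Admissible y) (hxy : O.le x y) :
    O.Admissible x := by
  obtain ⟨z, rfl⟩ := (O.le_iff _ _).1 hxy
  exact h.left

/-- An admissible product is reduced. -/
theorem Admissible.meet_eq_id {x y : Y} (h : O.Admissible (O.op x y)) :
    O.meet (O.inv x) y = O.idY := by
  obtain ⟨d, r, t, -, hr, rfl, hrt⟩ := O.exists_meet_factor (O.inv x) y
  have hx : x = O.op (O.inv r) (O.inv d) := by rw [← O.inv_op, ← hr, O.inv_invol]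
  by_contra hne
  refine h ⟨O.inv r, O.inv d, t, fun hd => hne ?_, ?_⟩
  · have hd := O.inv_eq_id hd
    subst hd
    rw [hr, O.op_meet, O.id_op, hrt]
  · rw [hx, O.inv_invol]
    simp only [O.op_assoc]

theorem Square.adm_right (hO : O.IsOre) {x y x' y' : Y} (h : O.Square x y x' y')
    (hx : O.Admissible x) (hy' : O.Admissible y') : O.Admissible y :=
  hO.2.1 x y y' ⟨h.1, _, h.2.2⟩ hx hy' h.2.2

theorem Square.adm (hO : O.IsOre) {x y x' y' : Y} (h : O.Square x y x' y')
    (hx : O.Admissible x) (hy : O.Admissible y) : O.Admissible x' ∧ O.Admissible y' :=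
  have h6 := hO.2.2 x y x' y' hx hy ⟨h.1, _, h.2.2⟩ h.2.2 (h.2.1 ▸ h.2.2)
  ⟨h6.1, h6.2.1⟩

/-- A square seen from the vertex `x`. -/
theorem Square.rotate (hO : O.IsOre) {x y x' y' : Y} (h : O.Square x y x' y')
    (hx : O.Admissible x) (hy : O.Admissible y) : O.Square (O.inv x) y' (O.inv x') y := by
  obtain ⟨-, -, h1, -, h2, h3, -⟩ :=
    hO.2.2 x y x' y' hx hy ⟨h.1, _, h.2.2⟩ h.2.2 (h.2.1 ▸ h.2.2)
  exact ⟨h1.1, h3, h2⟩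

/-- Transporting a reduced product `a □ b = p □ q` of admissible elements past `p`. -/
theorem exists_transport (hO : O.IsOre) {a b p q : Y} (ha : O.Admissible a)
    (hb : O.Admissible b) (hab : O.meet (O.inv a) b = O.idY) (h : O.op a b = O.op p q) :
    ∃ d a' p' a'' b₁ b', a = O.op d a' ∧ p = O.op d p' ∧ b = O.op b₁ b' ∧
      O.Square a' p' a'' b₁ ∧ O.Admissible p' ∧ O.Admissible a'' ∧
      O.meet (O.inv a'') b' = O.idY ∧ O.op a'' b' = q := by
  obtain ⟨d, a', p', -, rfl, rfl, hap⟩ := O.exists_meet_factor a p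
  rw [O.op_assoc, O.op_assoc] at h
  have h := O.cancel_left _ _ _ h
  obtain ⟨a'', b₁, hsq⟩ := O.exists_square hap (O.le_op a' b) (h ▸ O.le_op p' q)
  obtain ⟨b', rfl⟩ := (O.le_iff _ _).1
    (O.op_le_op_iff.1 (hsq.le (O.le_op a' b) (h ▸ O.le_op p' q)))
  have ha' := ha.right
  have hp' := hsq.adm_right hO ha' hb.left
  have hadm := hsq.adm hO ha' hp'
  refine ⟨d, a', p', a'', b₁, b', rfl, rfl, rfl, hsq, hp', hadm.1, ?_, ?_⟩
  · obtain ⟨c, r, t, hc, hr, rfl, -⟩ := O.exists_meet_factor (O.inv a'') b'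
    rw [hc]
    have hrot := hsq.rotate hO ha' hp'
    have hle : O.le (O.op b₁ c) (O.op b₁ (O.op c t)) := O.op_le_op_iff.2 (O.le_op _ _)
    have hjoin : O.op (O.inv a') p' = O.op (O.op b₁ c) r := by
      rw [hrot.2.1, hr, O.op_assoc]
    have hsq' : O.Square (O.inv a') (O.op b₁ c) r p' := by
      refine ⟨O.meet_eq_id_of_le hab ?_ hle, hjoin, O.le_op _ _, hjoin ▸ O.le_op _ _,
        fun s hs hs' => ?_⟩
      · rw [O.inv_op]
        exact O.le_op _ _
      · exact hrot.le hs (O.le_trans _ _ _ (O.le_op _ _) hs')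
    have hrot' := hsq'.rotate hO ha'.inv (hb.of_le hle)
    rw [O.inv_invol] at hrot'
    have hle' := hrot'.le (O.le_op a' b₁) (hsq.2.1 ▸ O.le_op p' a'')
    rw [O.op_le_op_iff] at hle'
    have := O.le_antisymm _ _ hle' (O.le_op b₁ c)
    exact O.cancel_left b₁ _ _ (by rw [this, O.op_id])
  · apply O.cancel_left p'
    rw [← O.op_assoc, ← hsq.2.1, O.op_assoc, h]

/-- A reduced product of admissible elements is admissible. -/
theorem Admissible.op (hO : O.IsOre) {a b : Y} (ha : O.Admissible a)
    (hb : O.Admissible b) (hab : O.meet (O.inv a) b = O.idY) : O.Admissible (O.op a b) := by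
  rintro ⟨x, y, z, hy, h⟩
  apply hy
  rw [O.op_assoc, O.op_assoc] at h
  obtain ⟨_, _, _, a₁, _, b₁, -, -, rfl, -, -, ha₁, hab₁, h₁⟩ :=
    exists_transport hO ha hb hab h
  have hb₁ := hb.right
  obtain ⟨d, a', y', a₂, b₂, b₃, rfl, hyd, rfl, hsq, hy', ha₂, hab₂, h₂⟩ :=
    exists_transport hO ha₁ hb₁ hab₁ h₁
  have hb₂ : b₂ = O.idY := by
    have hrot := (hsq.symm.rotate hO hy' ha₁.right).symm
    have hle := hrot.le (O.le_op a₂ b₃) (by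
      rw [h₂, hyd, O.inv_op, O.op_assoc]
      exact O.le_op _ _)
    have hle := O.op_le_op_iff.1 hle
    exact O.inv_eq_id (O.eq_id_of_meet hb₁.meet_eq_id (O.le_refl _) hle)
  have hy'id := hsq.eq_id_of_right hb₂
  have h₃ : a' = a₂ := by
    have := hsq.2.1
    rwa [hb₂, hy'id, O.op_id, O.id_op] at this
  subst h₃
  rw [hy'id, O.op_id] at hyd
  subst hyd
  rw [hb₂, O.id_op] at hb₁ hab₁
  obtain ⟨e, a₄, y₄, a₅, b₄, b₅, rfl, hye, rfl, hsq₄, hy₄, -, -, -⟩ :=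
    exists_transport hO ha₂ hb₁ hab₂ h₂
  have he : e = O.idY := O.eq_id_of_meet ha₁.meet_eq_id (hye ▸ O.le_op _ _) (O.le_op _ _)
  subst he
  rw [O.id_op] at hye hab₁
  have hrot := (hsq₄.rotate hO (by simpa only [O.id_op] using ha₂) hy₄)
  have hb₄ : b₄ = O.idY := by
    refine O.eq_id_of_meet hab₁ ?_ (O.le_op _ _)
    rw [O.inv_op, hye, hrot.2.1]
    exact O.le_op _ _
  exact O.inv_eq_id (hye.trans (hsq₄.eq_id_of_right hb₄))

variable (O)

theorem rdiv_op (x z : Y) : O.rdiv (O.op x z) x = z := by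
  have h : ∃ w, O.op x z = O.op x w := ⟨z, rfl⟩
  rw [rdiv, dif_pos h]
  exact (O.cancel_left _ _ _ h.choose_spec).symm

theorem ldiv_op (x z : Y) : O.ldiv (O.op x z) z = x := by
  have h : ∃ w, O.op x z = O.op w z := ⟨x, rfl⟩
  rw [ldiv, dif_pos h]
  exact (O.cancel_right _ _ _ h.choose_spec).symm

theorem star_op {a b : Y} (c : Y) (h : O.meet (O.inv a) b = O.idY) :
    O.star (O.op a (O.inv c)) (O.op c b) = O.op a b := by
  have hm : O.meet (O.inv (O.op a (O.inv c))) (O.op c b) = c := by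
    rw [O.inv_op, O.inv_invol, O.op_meet, h, O.op_id]
  rw [star, hm, ldiv_op, rdiv_op]

theorem exists_star_factor (f g : Y) : ∃ a b c, f = O.op a (O.inv c) ∧ g = O.op c b ∧
    O.meet (O.inv a) b = O.idY ∧ O.star f g = O.op a b := by
  obtain ⟨c, r, b, -, hr, rfl, h⟩ := O.exists_meet_factor (O.inv f) g
  have hf : f = O.op (O.inv r) (O.inv c) := by rw [← O.inv_op, ← hr, O.inv_invol]
  rw [← O.inv_invol r] at h
  exact ⟨_, b, c, hf, rfl, h, by rw [hf, O.star_op c h]⟩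

theorem id_star (f : Y) : O.star O.idY f = f := by
  have h := O.star_op (a := O.idY) (b := f) O.idY
    (by
      rw [O.inv_id]
      exact O.le_id (O.meet_le_left _ _))
  rwa [O.inv_id, O.id_op, O.id_op] at h

variable {O}

theorem inv_star_star {c h : Y} (hh : O.Admissible h) :
    O.star (O.inv c) (O.star c h) = h := by
  obtain ⟨u, v, d, rfl, rfl, -, hs⟩ := O.exists_star_factor c h
  rw [hs, O.inv_op, O.inv_invol]
  exact O.star_op u hh.meet_eq_id

theorem Admissible.star (hO : O.IsOre) {f g : Y} (hf : O.Admissible f)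
    (hg : O.Admissible g) : O.Admissible (O.star f g) := by
  obtain ⟨a, b, c, rfl, rfl, hab, hs⟩ := O.exists_star_factor f g
  rw [hs]
  exact hf.left.op hO hg.right hab

theorem op_star (hO : O.IsOre) {a b h : Y} (hab : O.Admissible (O.op a b))
    (hh : O.Admissible h) : O.star (O.op a b) h = O.star a (O.star b h) := by
  obtain ⟨u, v, d, rfl, rfl, huv, hs⟩ := O.exists_star_factor b h
  rw [hs]
  have hau : O.Admissible (O.op a u) := by
    rw [← O.op_assoc] at hab
    exact hab.left
  have huv' : O.Admissible (O.op u v) := hau.right.op hO hh.right huv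
  obtain ⟨w, t, m, rfl, hm, hwt, hs'⟩ := O.exists_star_factor a (O.op u v)
  rw [hs']
  have hmu : O.meet m u = O.idY := by
    refine O.meet_eq_id_of_le hau.meet_eq_id ?_ (O.le_refl _)
    rw [O.inv_op, O.inv_invol]
    exact O.le_op _ _
  obtain ⟨n, u', hsq⟩ := O.exists_square hmu (hm ▸ O.le_op m t) (O.le_op u v)
  have hv := hsq.le (hm ▸ O.le_op m t) (O.le_op u v)
  rw [hsq.2.1, O.op_le_op_iff] at hv
  obtain ⟨v', rfl⟩ := (O.le_iff _ _).1 hv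
  have ht : t = O.op u' v' := by
    apply O.cancel_left m
    rw [← hm, ← O.op_assoc, ← O.op_assoc, hsq.2.1]
  have hmadm : O.Admissible m := huv'.of_le (hm ▸ O.le_op m t)
  have hmu' : O.op (O.inv m) u = O.op u' (O.inv n) := (hsq.rotate hO hmadm hau.right).2.1
  have hwuv : O.meet (O.inv (O.op w u')) v' = O.idY := by
    rw [O.meet_eq_id_iff]
    intro k hk hk'
    have hnk : O.le (O.op n k) (O.inv (O.op (O.op w (O.inv m)) u)) := by
      rw [O.op_assoc, hmu', ← O.op_assoc, O.inv_op _ (O.inv n), O.inv_invol]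
      exact O.op_le_op_iff.2 hk
    have hnk' : O.le (O.op n k) (O.op n v') := O.op_le_op_iff.2 hk'
    rw [O.inv_op] at hnk
    obtain ⟨p, q, hpq⟩ := O.exists_square
      (O.meet_eq_id_of_le huv (O.le_refl _) hnk') (O.le_op _ _) hnk
    have hq := O.op_le_op_iff.1 (hpq.le (O.le_op _ _) hnk)
    have hrot := hpq.rotate hO hau.right.inv (hh.right.of_le hnk')
    rw [O.inv_invol] at hrot
    have hqm : O.le q m := by
      have := O.op_meet m (O.inv w) t
      rw [hwt, O.op_id] at this
      rw [← this]
      refine O.le_meet _ _ _ ?_ ?_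
      · rwa [O.inv_op, O.inv_invol] at hq
      · rw [← hm]
        exact O.le_trans _ _ _ hrot.2.2.2.1 (O.op_le_op_iff.2 hnk')
    have hle := hrot.le (hsq.2.1 ▸ O.le_op u n)
      (O.le_trans _ _ _ hqm (O.le_op m u'))
    rw [hsq.2.1, O.op_le_op_iff] at hle
    exact O.cancel_left n _ _ (by rw [O.op_id, O.le_antisymm _ _ hle (O.le_op n k)])
  have hstar := O.star_op (O.op d n) hwuv
  rw [ht, ← O.op_assoc w, ← hstar]
  congr 1
  · rw [O.op_assoc w, ← O.op_assoc (O.inv m), hmu']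
    simp only [O.op_assoc, O.inv_op]
  · simp only [O.op_assoc]

theorem star_assoc (hO : O.IsOre) {f g h : Y} (hf : O.Admissible f) (hg : O.Admissible g)
    (hh : O.Admissible h) : O.star (O.star f g) h = O.star f (O.star g h) := by
  obtain ⟨a, b, c, rfl, rfl, hab, hs⟩ := O.exists_star_factor f g
  rw [hs, op_star hO (hf.left.op hO hg.right hab) hh, op_star hO hg hh,
    op_star hO hf (hg.left.star hO (hg.right.star hO hh)),
    inv_star_star (hg.right.star hO hh)]

variable (O)

theorem inv_star (f : Y) : O.star (O.inv f) f = O.idY := by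
  have h := O.star_op (a := O.idY) (b := O.idY) f (O.le_id (O.meet_le_right _ _))
  rwa [O.id_op, O.op_id, O.op_id] at h

theorem star_id (f : Y) : O.star f O.idY = f := by
  have h := O.star_op (a := f) (b := O.idY) O.idY (O.le_id (O.meet_le_right _ _))
  rwa [O.inv_id, O.op_id, O.op_id] at h

end OreData

/-- The set `G` of admissible elements of an ore, equipped with the star product `⋆`, is
a group with identity `id`, in which the inverse of `g` is `g⁻¹`. -/
theorem stmt8 {Y : Type} (O : OreData Y) (hO : O.IsOre) :
    (∀ f, O.Admissible f → O.Admissible (O.inv f)) ∧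
    (∀ f g, O.Admissible f → O.Admissible g → O.Admissible (O.star f g)) ∧
    (∀ f g h : Y, O.Admissible f → O.Admissible g → O.Admissible h →
      O.star (O.star f g) h = O.star f (O.star g h)) ∧
    (∀ f, O.Admissible f → O.star O.idY f = f) ∧
    (∀ f, O.Admissible f → O.star f O.idY = f) ∧
    (∀ f, O.Admissible f → O.star f (O.inv f) = O.idY) ∧
    (∀ f, O.Admissible f → O.star (O.inv f) f = O.idY) := by
  refine ⟨fun _ hf => hf.inv, fun _ _ hf hg => hf.star hO hg,
    fun _ _ _ hf hg hh => OreData.star_assoc hO hf hg hh, fun f _ => O.id_star f,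
    fun f _ => O.star_id f, fun f _ => ?_, fun f _ => O.inv_star f⟩
  simpa only [O.inv_invol] using O.inv_star (O.inv f)
end
end

section
/- Let X be a set and let Y_X be the set of equivalence classes of maps f : [0, ℓ_f] → X (ℓ_f ∈ ℝ, ℓ_f ≥ 0), where f and g are equivalent iff ℓ_f = ℓ_g and the set {t : f(t) ≠ g(t)} is countable; order Y_X by 𝔣 ⪯ 𝔤 iff ℓ_f ≤ ℓ_g and f(t) = g(t) for all but countably many t ∈ [0, ℓ_f], and let id denote the class of maps of length 0. Then (Y_X, ⪯) is a median semilattice with bottom element id: ⪯ is a partial order, every pair has a greatest lower bound ∧, id ⪯ 𝔣 for all 𝔣, and for all 𝔣₁, 𝔣₂, 𝔣₃, 𝔤 ∈ Y_X the join (𝔣₁ ∧ 𝔣₂) ∨ (𝔣₂ ∧ 𝔣₃) ∨ (𝔣₁ ∧ 𝔣₃) exists and satisfies 𝔤 ∧ ((𝔣₁ ∧ 𝔣₂) ∨ (𝔣₂ ∧ 𝔣₃) ∨ (𝔣₁ ∧ 𝔣₃)) = (𝔤 ∧ 𝔣₁ ∧ 𝔣₂) ∨ (𝔤 ∧ 𝔣₂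 ∧ 𝔣₃) ∨ (𝔤 ∧ 𝔣₁ ∧ 𝔣₃). -/
noncomputable section

/-- A map `f : [0, ℓ] → X`, modelled as a pair of a nonnegative length `ℓ` and a total
function `ℝ → X` (only the values on `[0, ℓ]` matter). -/
def RawMap (X : Type) : Type := {p : ℝ × (ℝ → X) // 0 ≤ p.1}

/-- Two maps are equivalent iff they have the same length and agree off a countable
set. -/
def rEquiv {X : Type} (p q : RawMap X) : Prop :=
  p.1.1 = q.1.1 ∧ {t : ℝ | t ∈ Set.Icc 0 p.1.1 ∧ p.1.2 t ≠ q.1.2 t}.Countable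

theorem rEquiv_refl {X : Type} (p : RawMap X) : rEquiv p p := by
  refine ⟨rfl, ?_⟩
  convert Set.countable_empty
  ext t
  simp

theorem rEquiv_symm {X : Type} {p q : RawMap X} (h : rEquiv p q) : rEquiv q p := by
  refine ⟨h.1.symm, h.2.mono ?_⟩
  intro t ht
  obtain ⟨ht1, ht2⟩ := ht
  rw [← h.1] at ht1
  exact ⟨ht1, fun hh => ht2 hh.symm⟩

theorem rEquiv_trans {X : Type} {p q r : RawMap X} (h₁ : rEquiv p q) (h₂ : rEquiv q r) :
    rEquiv p r := by
  refine ⟨h₁.1.trans h₂.1, (h₁.2.union h₂.2).mono ?_⟩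
  intro t ht
  obtain ⟨ht1, ht2⟩ := ht
  by_cases hpq : p.1.2 t = q.1.2 t
  · right
    refine ⟨?_, fun hh => ht2 (hpq.trans hh)⟩
    rwa [← h₁.1]
  · exact Or.inl ⟨ht1, hpq⟩

/-- The equivalence relation on maps. -/
def rSetoid (X : Type) : Setoid (RawMap X) :=
  ⟨rEquiv, rEquiv_refl, rEquiv_symm, rEquiv_trans⟩

/-- The set `Y_X` of equivalence classes of maps `[0, ℓ] → X`. -/
def YX (X : Type) : Type := Quotient (rSetoid X)

/-- The partial order on `Y_X`: `𝔣 ⪯ 𝔤` iff `ℓ_f ≤ ℓ_g` and the maps agree on all but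
countably many points of `[0, ℓ_f]`. -/
def Yle {X : Type} (f g : YX X) : Prop :=
  ∃ p q : RawMap X, Quotient.mk (rSetoid X) p = f ∧ Quotient.mk (rSetoid X) q = g ∧
    p.1.1 ≤ q.1.1 ∧ {t : ℝ | t ∈ Set.Icc 0 p.1.1 ∧ p.1.2 t ≠ q.1.2 t}.Countable

/-- The class of maps of length `0`. -/
def Yid (X : Type) [Nonempty X] : YX X :=
  Quotient.mk (rSetoid X) ⟨(0, fun _ => Classical.arbitrary X), le_refl 0⟩

/-- `m` is the meet (greatest lower bound) of `f` and `g`. -/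
def YIsMeet {X : Type} (f g m : YX X) : Prop :=
  Yle m f ∧ Yle m g ∧ ∀ s, Yle s f → Yle s g → Yle s m

/-- `j` is the join (least upper bound) of `a`, `b`, `c`. -/
def YIsJoin3 {X : Type} (a b c j : YX X) : Prop :=
  Yle a j ∧ Yle b j ∧ Yle c j ∧ ∀ s, Yle a s → Yle b s → Yle c s → Yle j s

open Classical in
/-- The meet of `f` and `g` (it exists and is unique). -/
def Ymeet {X : Type} (f g : YX X) : YX X :=
  if h : ∃ m, YIsMeet f g m then h.choose else f

theorem Yle_mk {X : Type} (p q : RawMap X) :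
    Yle (Quotient.mk (rSetoid X) p) (Quotient.mk (rSetoid X) q) ↔
      p.1.1 ≤ q.1.1 ∧ {t : ℝ | t ∈ Set.Icc 0 p.1.1 ∧ p.1.2 t ≠ q.1.2 t}.Countable := by
  refine ⟨?_, fun h => ⟨p, q, rfl, rfl, h⟩⟩
  rintro ⟨p', q', hp, hq, hle, hc⟩
  have hp : rEquiv p' p := Quotient.exact hp
  have hq : rEquiv q' q := Quotient.exact hq
  refine ⟨hp.1 ▸ hq.1 ▸ hle, ((hp.2.union hc).union hq.2).mono ?_⟩
  rintro t ⟨ht, hne⟩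
  rw [← hp.1] at ht
  by_cases h₁ : p'.1.2 t = p.1.2 t
  · by_cases h₂ : p'.1.2 t = q'.1.2 t
    · exact Or.inr ⟨⟨ht.1, ht.2.trans hle⟩, fun h₃ => hne (h₁.symm.trans (h₂.trans h₃))⟩
    · exact Or.inl (Or.inr ⟨ht, h₂⟩)
  · exact Or.inl (Or.inl ⟨ht, h₁⟩)

theorem Yle_refl {X : Type} (f : YX X) : Yle f f := by
  induction f using Quotient.inductionOn with
  | h p => exact (Yle_mk p p).2 ⟨le_rfl, (rEquiv_refl p).2⟩

theorem Yle_antisymm {X : Type} {f g : YX X} (hfg : Yle f g) (hgf : Yle g f) : f = g := by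
  induction f, g using Quotient.inductionOn₂ with
  | h p q =>
    have h₁ := (Yle_mk p q).1 hfg
    exact Quotient.sound ⟨h₁.1.antisymm ((Yle_mk q p).1 hgf).1, h₁.2⟩

theorem Yle_trans {X : Type} {f g h : YX X} (hfg : Yle f g) (hgh : Yle g h) : Yle f h := by
  induction f, g, h using Quotient.inductionOn₃ with
  | h p q r =>
    obtain ⟨h₁, c₁⟩ := (Yle_mk p q).1 hfg
    obtain ⟨h₂, c₂⟩ := (Yle_mk q r).1 hgh
    refine (Yle_mk p r).2 ⟨h₁.trans h₂, (c₁.union c₂).mono ?_⟩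
    rintro t ⟨ht, hne⟩
    by_cases h : p.1.2 t = q.1.2 t
    · exact Or.inr ⟨⟨ht.1, ht.2.trans h₁⟩, fun h' => hne (h.trans h')⟩
    · exact Or.inl ⟨ht, h⟩

theorem Yid_Yle {X : Type} [Nonempty X] (f : YX X) : Yle (Yid X) f := by
  induction f using Quotient.inductionOn with
  | h p =>
    refine (Yle_mk _ p).2 ⟨p.2, (Set.countable_singleton (0 : ℝ)).mono ?_⟩
    rintro t ⟨ht, -⟩
    exact le_antisymm ht.2 ht.1

/-- Two elements with a common upper bound are comparable. -/
theorem Yle_total_of_Yle {X : Type} {f g h : YX X} (hf : Yle f h) (hg : Yle g h) :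
    Yle f g ∨ Yle g f := by
  induction f, g, h using Quotient.inductionOn₃ with
  | h p q r =>
    obtain ⟨-, c₁⟩ := (Yle_mk p r).1 hf
    obtain ⟨-, c₂⟩ := (Yle_mk q r).1 hg
    rcases le_total p.1.1 q.1.1 with hl | hl
    · refine Or.inl ((Yle_mk p q).2 ⟨hl, (c₁.union c₂).mono ?_⟩)
      rintro t ⟨ht, hne⟩
      by_cases h : p.1.2 t = r.1.2 t
      · exact Or.inr ⟨⟨ht.1, ht.2.trans hl⟩, fun h' => hne (h.trans h'.symm)⟩
      · exact Or.inl ⟨ht, h⟩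
    · refine Or.inr ((Yle_mk q p).2 ⟨hl, (c₁.union c₂).mono ?_⟩)
      rintro t ⟨ht, hne⟩
      by_cases h : q.1.2 t = r.1.2 t
      · exact Or.inl ⟨⟨ht.1, ht.2.trans hl⟩, fun h' => hne (h.trans h'.symm)⟩
      · exact Or.inr ⟨ht, h⟩

/-- If a set of reals is countable on every `[0, l]` with `l ∈ S`, then it is countable on
`[0, sSup S]`. -/
theorem countable_inter_Icc_sSup {S A : Set ℝ} (hne : S.Nonempty) (hbdd : BddAbove S)
    (hS : ∀ l ∈ S, (Set.Icc 0 l ∩ A).Countable) : (Set.Icc 0 (sSup S) ∩ A).Countable := by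
  obtain ⟨u, -, hu, huS⟩ := exists_seq_tendsto_sSup hne hbdd
  refine ((Set.countable_singleton (sSup S)).union
    (Set.countable_iUnion fun n => hS (u n) (huS n))).mono ?_
  rintro t ⟨ht, htA⟩
  rcases ht.2.eq_or_lt with h | h
  · exact Or.inl h
  · obtain ⟨n, hn⟩ := (hu.eventually (lt_mem_nhds h)).exists
    exact Or.inr (Set.mem_iUnion.2 ⟨n, ⟨ht.1, hn.le⟩, htA⟩)

theorem exists_YIsMeet {X : Type} (f g : YX X) : ∃ m, YIsMeet f g m := by
  induction f, g using Quotient.inductionOn₂ with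
  | h p q =>
    set A : Set ℝ := {t | p.1.2 t ≠ q.1.2 t}
    set S : Set ℝ := {l | 0 ≤ l ∧ l ≤ p.1.1 ∧ l ≤ q.1.1 ∧ (Set.Icc 0 l ∩ A).Countable}
    have h0 : (0 : ℝ) ∈ S :=
      ⟨le_rfl, p.2, q.2, (Set.countable_singleton (0 : ℝ)).mono
        fun t ht => le_antisymm ht.1.2 ht.1.1⟩
    have hbdd : BddAbove S := ⟨p.1.1, fun l hl => hl.2.1⟩
    have hc := countable_inter_Icc_sSup ⟨0, h0⟩ hbdd fun l hl => hl.2.2.2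
    refine ⟨Quotient.mk (rSetoid X) ⟨(sSup S, p.1.2), le_csSup hbdd h0⟩,
      (Yle_mk _ p).2 ⟨csSup_le ⟨0, h0⟩ fun l hl => hl.2.1, ?_⟩,
      (Yle_mk _ q).2 ⟨csSup_le ⟨0, h0⟩ fun l hl => hl.2.2.1, hc⟩, ?_⟩
    · exact Set.countable_empty.mono fun t ht => ht.2 rfl
    · intro s hsp hsq
      induction s using Quotient.inductionOn with
      | h r =>
        obtain ⟨h₁, c₁⟩ := (Yle_mk r p).1 hsp
        obtain ⟨h₂, c₂⟩ := (Yle_mk r q).1 hsq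
        refine (Yle_mk r _).2 ⟨le_csSup hbdd ⟨r.2, h₁, h₂, (c₁.union c₂).mono ?_⟩, c₁⟩
        rintro t ⟨ht, hne⟩
        by_cases h : r.1.2 t = p.1.2 t
        · exact Or.inr ⟨ht, fun h' => hne (h.symm.trans h')⟩
        · exact Or.inl ⟨ht, h⟩

theorem Ymeet_isMeet {X : Type} (f g : YX X) : YIsMeet f g (Ymeet f g) := by
  rw [Ymeet, dif_pos (exists_YIsMeet f g)]
  exact (exists_YIsMeet f g).choose_spec

theorem Ymeet_mono_right {X : Type} (g : YX X) {a b : YX X} (h : Yle a b) :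
    Yle (Ymeet g a) (Ymeet g b) :=
  have hm := Ymeet_isMeet g a
  (Ymeet_isMeet g b).2.2 _ hm.1 (Yle_trans hm.2.1 h)

/-- Three pairwise comparable elements have a greatest one among them. -/
theorem exists_greatest_of_comparable {X : Type} {a b c : YX X} (hab : Yle a b ∨ Yle b a)
    (hbc : Yle b c ∨ Yle c b) (hac : Yle a c ∨ Yle c a) :
    ∃ j, (j = a ∨ j = b ∨ j = c) ∧ Yle a j ∧ Yle b j ∧ Yle c j := by
  have ha := Yle_refl a
  have hb := Yle_refl b
  have hc := Yle_refl c
  rcases hab with hab | hab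
  · rcases hbc with hbc | hbc
    · exact ⟨c, by simp, Yle_trans hab hbc, hbc, hc⟩
    · exact ⟨b, by simp, hab, hb, hbc⟩
  · rcases hac with hac | hac
    · exact ⟨c, by simp, hac, Yle_trans hab hac, hc⟩
    · exact ⟨a, by simp, ha, hab, hac⟩

/-- `(Y_X, ⪯)` is a median semilattice with bottom element `id`: `⪯` is a partial order
with all binary meets and bottom element the length-0 class, and for all
`f₁, f₂, f₃, g` the join `(f₁ ∧ f₂) ∨ (f₂ ∧ f₃) ∨ (f₁ ∧ f₃)` exists and satisfies
`g ∧ ((f₁ ∧ f₂) ∨ (f₂ ∧ f₃) ∨ (f₁ ∧ f₃)) =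
 (g ∧ f₁ ∧ f₂) ∨ (g ∧ f₂ ∧ f₃) ∨ (g ∧ f₁ ∧ f₃)`. -/
theorem stmt16 (X : Type) [Nonempty X] :
    (∀ f : YX X, Yle f f) ∧
    (∀ f g : YX X, Yle f g → Yle g f → f = g) ∧
    (∀ f g h : YX X, Yle f g → Yle g h → Yle f h) ∧
    (∀ f : YX X, Yle (Yid X) f) ∧
    (∀ f g : YX X, YIsMeet f g (Ymeet f g)) ∧
    (∀ f₁ f₂ f₃ g : YX X, ∃ j : YX X,
      YIsJoin3 (Ymeet f₁ f₂) (Ymeet f₂ f₃) (Ymeet f₁ f₃) j ∧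
      YIsJoin3 (Ymeet g (Ymeet f₁ f₂)) (Ymeet g (Ymeet f₂ f₃))
        (Ymeet g (Ymeet f₁ f₃)) (Ymeet g j)) := by
  refine ⟨Yle_refl, fun _ _ => Yle_antisymm, fun _ _ _ => Yle_trans, Yid_Yle, Ymeet_isMeet, ?_⟩
  intro f₁ f₂ f₃ g
  have h₁₂ := Ymeet_isMeet f₁ f₂
  have h₂₃ := Ymeet_isMeet f₂ f₃
  have h₁₃ := Ymeet_isMeet f₁ f₃
  obtain ⟨j, hj, ha, hb, hc⟩ := exists_greatest_of_comparable
    (Yle_total_of_Yle h₁₂.2.1 h₂₃.1) (Yle_total_of_Yle h₂₃.2.1 h₁₃.2.1)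
    (Yle_total_of_Yle h₁₂.1 h₁₃.1)
  refine ⟨j, ⟨ha, hb, hc, fun s h₁ h₂ h₃ => ?_⟩, Ymeet_mono_right g ha, Ymeet_mono_right g hb,
    Ymeet_mono_right g hc, fun s h₁ h₂ h₃ => ?_⟩ <;>
  rcases hj with rfl | rfl | rfl <;> assumption
end
end

section
/- Let T be an ℝ-tree and let G be a group acting freely on T by isometries. Let L ⊆ T be a line such that Stab_G(L) acts on L with dense orbits. Then for every g ∈ G, the intersection gL ∩ L is either empty, a single point, or equal to L. -/
open Cardinal

noncomputable section

/-- A metric space is *geodesic* if every pair of points is joined by a geodesic. -/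
def GeodesicSpace (T : Type) [MetricSpace T] : Prop :=
  ∀ x y : T, ∃ γ : ℝ → T, γ 0 = x ∧ γ (dist x y) = y ∧
    ∀ s ∈ Set.Icc (0:ℝ) (dist x y), ∀ t ∈ Set.Icc (0:ℝ) (dist x y),
      dist (γ s) (γ t) = |s - t|

/-- 0-hyperbolicity: for all basepoints `p`, the Gromov products satisfy
`(x,y)_p ≥ min ((x,z)_p, (z,y)_p)`. -/
def ZeroHyp (T : Type) [MetricSpace T] : Prop :=
  ∀ p x y z : T,
    min ((dist x p + dist z p - dist x z) / 2) ((dist z p + dist y p - dist z y) / 2) ≤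
      (dist x p + dist y p - dist x y) / 2

/-- An ℝ-tree: a geodesic metric space which is 0-hyperbolic. -/
def IsRTree (T : Type) [MetricSpace T] : Prop := GeodesicSpace T ∧ ZeroHyp T

/-- The valence of a point `x`: the cardinality of the set of connected components of
`T \ {x}`. -/
def valence (T : Type) [MetricSpace T] (x : T) : Cardinal :=
  #(ConnectedComponents {y : T // y ≠ x})

/-- An action of a group `G` by isometries, given as a map `φ : G → T → T`. -/
def IsometricAction {G T : Type} [Group G] [MetricSpace T] (φ : G → T → T) : Prop :=
  (∀ g : G, Isometry (φ g)) ∧ (∀ x : T, φ 1 x = x) ∧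
  (∀ g h : G, ∀ x : T, φ (g * h) x = φ g (φ h x))

/-- The action is free. -/
def FreeAction {G T : Type} [Group G] (φ : G → T → T) : Prop :=
  ∀ g : G, ∀ x : T, φ g x = x → g = 1

/-- The action is transitive. -/
def TransAction {G T : Type} (φ : G → T → T) : Prop :=
  ∀ x y : T, ∃ g : G, φ g x = y

/-- A line in a metric space: the image of an isometric embedding of ℝ. -/
def IsLine {T : Type} [MetricSpace T] (L : Set T) : Prop :=
  ∃ γ : ℝ → T, Isometry γ ∧ Set.range γ = L

/-- The (setwise) stabiliser of a subset `L` under the action `φ`. -/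
def setStab {G T : Type} (φ : G → T → T) (L : Set T) : Set G :=
  {g | φ g '' L = L}

/-- In a 0-hyperbolic space, isometric embeddings of `ℝ` that agree at `a` and `b` agree on
`[a, b]`. -/
theorem ZeroHyp.eq_of_mem_Icc {T : Type} [MetricSpace T] (hT : ZeroHyp T) {α β : ℝ → T}
    (hα : Isometry α) (hβ : Isometry β) {a b t : ℝ} (ha : α a = β a) (hb : α b = β b)
    (ht : t ∈ Set.Icc a b) : α t = β t := by
  obtain ⟨h1, h2⟩ := ht
  have h := hT (α a) (α t) (β t) (α b)
  have e1 : dist (α t) (α a) = t - a := by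
    rw [hα.dist_eq, Real.dist_eq, abs_of_nonneg (by linarith)]
  have e2 : dist (α b) (α a) = b - a := by
    rw [hα.dist_eq, Real.dist_eq, abs_of_nonneg (by linarith)]
  have e3 : dist (α t) (α b) = b - t := by
    rw [hα.dist_eq, dist_comm, Real.dist_eq, abs_of_nonneg (by linarith)]
  have e4 : dist (β t) (α a) = t - a := by
    rw [ha, hβ.dist_eq, Real.dist_eq, abs_of_nonneg (by linarith)]
  have e5 : dist (α b) (β t) = b - t := by
    rw [hb, hβ.dist_eq, Real.dist_eq, abs_of_nonneg (by linarith)]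
  rw [e1, e2, e3, e4, e5] at h
  apply dist_le_zero.mp
  rcases min_le_iff.mp h with h | h <;> linarith

/-- Two isometric embeddings of `ℝ` that meet and are translated by the same amount under an
injective map coincide. -/
theorem ZeroHyp.eq_of_translation {T : Type} [MetricSpace T] (hT : ZeroHyp T) {α β : ℝ → T}
    (hα : Isometry α) (hβ : Isometry β) {F : T → T} (hF : Function.Injective F) {a s : ℝ}
    (hs : 0 < s) (ha : α a = β a) (hFα : ∀ t, F (α t) = α (t + s))
    (hFβ : ∀ t, F (β t) = β (t + s)) : α = β := by
  have hpos : ∀ n : ℕ, α (a + n * s) = β (a + n * s) := by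
    intro n
    induction n with
    | zero => simpa using ha
    | succ n ih =>
      have e : a + ((n + 1 : ℕ) : ℝ) * s = a + n * s + s := by push_cast; ring
      rw [e, ← hFα, ← hFβ, ih]
  have hneg : ∀ n : ℕ, α (a - n * s) = β (a - n * s) := by
    intro n
    induction n with
    | zero => simpa using ha
    | succ n ih =>
      have e : a - ((n + 1 : ℕ) : ℝ) * s + s = a - n * s := by push_cast; ring
      apply hF
      rw [hFα, hFβ, e, ih]
  funext t
  obtain ⟨n, hn⟩ := exists_nat_ge (|t - a| / s)
  rw [div_le_iff₀ hs] at hn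
  have := abs_le.mp hn
  exact hT.eq_of_mem_Icc hα hβ (hneg n) (hpos n) ⟨by linarith, by linarith⟩

/-- Two pairs of reals at the same distance differ by an isometry `t ↦ σ * t + e` of `ℝ`. -/
theorem exists_affine_of_abs_sub_eq {a b c d : ℝ} (h : |c - d| = |a - b|) :
    ∃ σ e : ℝ, (σ = 1 ∨ σ = -1) ∧ σ * a + e = c ∧ σ * b + e = d := by
  rcases abs_eq_abs.mp h with h | h
  · exact ⟨1, c - a, .inl rfl, by ring, by linarith⟩
  · exact ⟨-1, c + a, .inr rfl, by ring, by linarith⟩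

/-- An element of a free isometric action mapping a line into itself translates it. -/
theorem FreeAction.exists_translation {G T : Type} [Group G] [MetricSpace T] {φ : G → T → T}
    (hact : IsometricAction φ) (hfree : FreeAction φ) {γ : ℝ → T} (hγ : Isometry γ) {h : G}
    (hh : φ h '' Set.range γ ⊆ Set.range γ) : ∃ s : ℝ, ∀ t, φ h (γ t) = γ (t + s) := by
  have hex : ∀ t, ∃ u, γ u = φ h (γ t) := fun t => hh ⟨γ t, ⟨t, rfl⟩, rfl⟩
  choose f hf using hex
  have hd : ∀ t u, |f t - f u| = |t - u| := by
    intro t u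
    rw [← Real.dist_eq, ← Real.dist_eq, ← hγ.dist_eq, hf, hf, (hact.1 h).dist_eq, hγ.dist_eq]
  have hfix : ∀ t, f t = t → ∀ u, f u = u := by
    intro t ht u
    have h1 : h = 1 := hfree h (γ t) (by rw [← hf, ht])
    apply hγ.injective
    rw [hf, h1, hact.2.1]
  refine ⟨f 0, fun t => ?_⟩
  rw [← hf]
  congr 1
  by_contra hne
  have hne0 : f 0 ≠ 0 := fun h0 => hne (by rw [hfix 0 h0 t, h0, add_zero])
  have ht : f t = f 0 - t := by
    rcases abs_eq_abs.mp (hd t 0) with h | h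
    · exact absurd (by linarith) hne
    · linarith
  have hne' : t ≠ 0 := by
    rintro rfl
    exact hne (by ring)
  have hmid : f (f 0 / 2) ≠ f 0 / 2 := fun h => hne0 (hfix _ h 0)
  rcases abs_eq_abs.mp (hd (f 0 / 2) 0) with h | h
  · rcases abs_eq_abs.mp (hd t (f 0 / 2)) with h' | h'
    · exact hne' (by linarith)
    · exact hne0 (by linarith)
  · exact hmid (by linarith)

/-- If a group `G` acts freely by isometries on an ℝ-tree `T` and `L` is a line whose
stabiliser acts on `L` with dense orbits, then for every `g ∈ G` the intersection
`gL ∩ L` is empty, a single point, or all of `L`. -/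
theorem stmt17 (T : Type) [MetricSpace T] (hT : IsRTree T)
    (G : Type) [Group G] (φ : G → T → T)
    (hact : IsometricAction φ) (hfree : FreeAction φ)
    (L : Set T) (hL : IsLine L)
    (hdense : ∀ x ∈ L, ∀ y ∈ L, ∀ ε : ℝ, 0 < ε →
      ∃ g ∈ setStab φ L, dist (φ g x) y < ε) :
    ∀ g : G, (φ g '' L) ∩ L = ∅ ∨ (∃ p : T, (φ g '' L) ∩ L = {p}) ∨
      (φ g '' L) ∩ L = L := by
  intro g
  obtain ⟨γ, hγ, rfl⟩ := hL
  obtain ⟨hiso, hone, hmul⟩ := id hact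
  rcases Set.eq_empty_or_nonempty ((φ g '' Set.range γ) ∩ Set.range γ) with h0 | ⟨p, hp⟩
  · exact .inl h0
  by_cases hp' : ∀ q ∈ (φ g '' Set.range γ) ∩ Set.range γ, q = p
  · exact .inr (.inl ⟨p, Set.eq_singleton_iff_unique_mem.mpr ⟨hp, hp'⟩⟩)
  refine .inr (.inr (Set.inter_eq_right.mpr ?_))
  push Not at hp'
  obtain ⟨q, hq, hqp⟩ := hp'
  obtain ⟨⟨_, ⟨c, rfl⟩, hc⟩, ⟨a, rfl⟩⟩ := hp
  obtain ⟨⟨_, ⟨d, rfl⟩, hd⟩, ⟨b, rfl⟩⟩ := hq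
  wlog hab : a < b generalizing a b c d
  · refine this d b hd c a (Ne.symm hqp) hc (lt_of_le_of_ne (not_lt.mp hab) ?_)
    rintro rfl
    exact hqp rfl
  have hcd : |c - d| = |a - b| := by
    rw [← Real.dist_eq, ← Real.dist_eq, ← hγ.dist_eq a b, ← hc, ← hd, (hiso g).dist_eq,
      hγ.dist_eq]
  obtain ⟨σ, e, hσ, hσa, hσb⟩ := exists_affine_of_abs_sub_eq hcd
  set δ : ℝ → T := fun t => φ g (γ (σ * t + e)) with hδ
  have hδiso : Isometry δ := by
    refine Isometry.of_dist_eq fun t u => ?_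
    rw [hδ, (hiso g).dist_eq, hγ.dist_eq, Real.dist_eq, Real.dist_eq]
    rcases hσ with rfl | rfl
    · congr 1; ring
    · rw [abs_sub_comm t u]; congr 1; ring
  have ha : γ a = δ a := by rw [hδ]; simp only [hσa, hc]
  have hb : γ b = δ b := by rw [hδ]; simp only [hσb, hd]
  have hIcc : ∀ t ∈ Set.Icc a b, γ t = δ t := fun t ht =>
    hT.2.eq_of_mem_Icc hγ hδiso ha hb ht
  obtain ⟨h, hh, hlt⟩ := hdense (γ a) ⟨a, rfl⟩ (γ (a + (b - a) / 2)) ⟨_, rfl⟩ ((b - a) / 2)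
    (by linarith)
  obtain ⟨s, hs⟩ := hfree.exists_translation hact hγ (h := h) (le_of_eq hh)
  rw [hs, hγ.dist_eq, Real.dist_eq, abs_lt] at hlt
  have hs0 : 0 < s := by linarith
  have hsb : γ (a + s) = δ (a + s) := hIcc _ ⟨by linarith, by linarith⟩
  have hconj : ∀ t, φ (g * h * g⁻¹) (φ g (γ t)) = φ g (γ (t + s)) := by
    intro t
    rw [← hmul, inv_mul_cancel_right, hmul, hs]
  have hδs : ∀ t, φ h (δ t) = δ (t + s) := by
    rcases hσ with rfl | rfl
    · have hk : ∀ t, φ (g * h * g⁻¹) (δ t) = δ (t + s) := fun t => by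
        simp only [hδ, hconj]; congr 2; ring
      have hkh : h⁻¹ * (g * h * g⁻¹) = 1 := by
        refine hfree _ (γ a) ?_
        rw [hmul, ha, hk, ← hsb, ← hs, ← hmul, inv_mul_cancel, hone, ha]
      rw [inv_mul_eq_one] at hkh
      intro t
      rw [hkh, ← hk, ← hkh]
    · have hk : ∀ t, φ (g * h * g⁻¹) (δ (t + s)) = δ t := fun t => by
        simp only [hδ, hconj]; congr 2; ring
      have hkh : g * h * g⁻¹ * h = 1 := by
        refine hfree _ (γ a) ?_
        rw [hmul, hs, hsb, hk, ha]
      intro t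
      rw [← hk t, ← hmul, mul_eq_one_iff_eq_inv.mp hkh, mul_inv_cancel, hone]
  have hγδ : γ = δ := hT.2.eq_of_translation hγ hδiso (hiso h).injective hs0 ha hs hδs
  rintro _ ⟨t, rfl⟩
  exact ⟨γ (σ * t + e), ⟨_, rfl⟩, (congrFun hγδ t).symm⟩
end
end

section
/- Let κ ≤ 2^ℵ₀ be a cardinal, let T be an ℝ-tree which is not a single point, and let G be a group acting freely and transitively on T by isometries. If for every line L ⊆ T the orbit space Stab_G(L)\L (the set of orbits of the Stab_G(L)-action on L) has cardinality ≥ κ, then every point of T has valence ≥ κ. -/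
open Cardinal

noncomputable section

/-- The set of orbits of the action of the stabiliser of `L` on `L`. -/
def stabOrbitSpace {G T : Type} (φ : G → T → T) (L : Set T) : Set (Set T) :=
  {C | ∃ x ∈ L, C = {y : T | ∃ g ∈ setStab φ L, φ g x = y}}

/-- The map `f` restricts to an isometric embedding of the interval `[a, b]`. -/
def IsGeodesicOn {T : Type} [MetricSpace T] (f : ℝ → T) (a b : ℝ) : Prop :=
  ∀ s ∈ Set.Icc a b, ∀ t ∈ Set.Icc a b, dist (f s) (f t) = |s - t|

/-- The Gromov product of `x` and `y` based at `p`. -/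
def gromovProd {T : Type} [MetricSpace T] (p x y : T) : ℝ :=
  (dist x p + dist y p - dist x y) / 2

section Tree

variable {T : Type} [MetricSpace T]

theorem ZeroHyp.min_le_gromovProd (hT : ZeroHyp T) (p x y z : T) :
    min (gromovProd p x z) (gromovProd p z y) ≤ gromovProd p x y :=
  hT p x y z

theorem gromovProd_comm (p x y : T) : gromovProd p x y = gromovProd p y x := by
  simp only [gromovProd, dist_comm x y]; ring

theorem gromovProd_le_right (p x y : T) : gromovProd p x y ≤ dist y p := by
  have := dist_triangle x y p
  unfold gromovProd; linarith

theorem gromovProd_le_left (p x y : T) : gromovProd p x y ≤ dist x p := by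
  rw [gromovProd_comm]; exact gromovProd_le_right p y x

theorem ZeroHyp.four_point (hT : ZeroHyp T) (p x y z : T) :
    dist x y + dist z p ≤ max (dist x z + dist y p) (dist x p + dist z y) := by
  rcases min_le_iff.1 (hT p x y z) with h | h
  · exact le_max_of_le_left (by linarith)
  · exact le_max_of_le_right (by linarith)

theorem Isometry.isGeodesicOn {f : ℝ → T} (hf : Isometry f) (a b : ℝ) : IsGeodesicOn f a b :=
  fun s _ t _ => by rw [hf.dist_eq, Real.dist_eq]

theorem IsGeodesicOn.dist_eq_sub {f : ℝ → T} {a b s t : ℝ} (hf : IsGeodesicOn f a b)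
    (has : a ≤ s) (hst : s ≤ t) (htb : t ≤ b) : dist (f s) (f t) = t - s := by
  rw [hf s ⟨has, hst.trans htb⟩ t ⟨has.trans hst, htb⟩, abs_sub_comm,
    abs_of_nonneg (sub_nonneg.2 hst)]

theorem isGeodesicOn_of_le {f : ℝ → T} {a b : ℝ}
    (h : ∀ s t, a ≤ s → s ≤ t → t ≤ b → dist (f s) (f t) = t - s) : IsGeodesicOn f a b := by
  intro s hs t ht
  rcases le_total s t with hst | hst
  · rw [h s t hs.1 hst ht.2, abs_sub_comm, abs_of_nonneg (sub_nonneg.2 hst)]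
  · rw [dist_comm, h t s ht.1 hst hs.2, abs_of_nonneg (sub_nonneg.2 hst)]

/-- In a 0-hyperbolic space, two geodesics overlapping in a nondegenerate interval glue to a
geodesic. -/
theorem IsGeodesicOn.glue (hT : ZeroHyp T) {f : ℝ → T} {a b c d : ℝ} (hac : IsGeodesicOn f a c)
    (hbd : IsGeodesicOn f b d) (hab : a ≤ b) (hbc : b < c) :
    IsGeodesicOn f a d := by
  refine isGeodesicOn_of_le fun s t has hst htd => ?_
  rcases le_total t c with htc | htc
  · exact hac.dist_eq_sub has hst htc
  rcases le_total b s with hbs | hbs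
  · exact hbd.dist_eq_sub hbs hst htd
  have h1 := hac.dist_eq_sub has (hbs.trans hbc.le) le_rfl
  have h2 := hbd.dist_eq_sub le_rfl (hbc.le.trans htc) htd
  have h3 := hac.dist_eq_sub hab hbc.le le_rfl
  have h4 := hac.dist_eq_sub has hbs hbc.le
  have h5 := hbd.dist_eq_sub hbc.le htc htd
  have h6 := dist_triangle (f s) (f c) (f t)
  have h7 := hT.four_point (f t) (f s) (f c) (f b)
  rcases le_max_iff.1 h7 with h | h <;> linarith

theorem IsGeodesicOn.eq_of_endpoints (hT : ZeroHyp T) {f g : ℝ → T} {a b u : ℝ}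
    (hf : IsGeodesicOn f a b) (hg : IsGeodesicOn g a b) (ha : f a = g a) (hb : f b = g b)
    (hau : a ≤ u) (hub : u ≤ b) : f u = g u := by
  have h1 := hf.dist_eq_sub le_rfl hau hub
  have h2 := hf.dist_eq_sub hau hub le_rfl
  have h3 := hg.dist_eq_sub le_rfl hau hub
  have h4 := hg.dist_eq_sub hau hub le_rfl
  have h5 := hf.dist_eq_sub le_rfl (hau.trans hub) le_rfl
  rw [← ha] at h3
  rw [← hb] at h4
  have h6 := hT.four_point (f b) (f u) (g u) (f a)
  rw [dist_comm (f u) (f a)] at h6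
  refine dist_le_zero.1 ?_
  rcases le_max_iff.1 h6 with h | h <;> linarith

/-- Two geodesics issuing from `p` agree up to the Gromov product of their endpoints. -/
theorem IsGeodesicOn.eq_of_le_gromovProd (hT : ZeroHyp T) {α β : ℝ → T} {a b u : ℝ} {p : T}
    (hα : IsGeodesicOn α 0 a) (hβ : IsGeodesicOn β 0 b) (ha : 0 ≤ a) (hb : 0 ≤ b)
    (hα0 : α 0 = p) (hβ0 : β 0 = p) (hu : 0 ≤ u)
    (hup : u ≤ gromovProd p (α a) (β b)) : α u = β u := by
  have a1 := hα.dist_eq_sub le_rfl ha le_rfl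
  have b1 := hβ.dist_eq_sub le_rfl hb le_rfl
  have hua : u ≤ a := by
    have := hup.trans (gromovProd_le_left _ _ _)
    rw [dist_comm, ← hα0] at this; linarith
  have hub : u ≤ b := by
    have := hup.trans (gromovProd_le_right _ _ _)
    rw [dist_comm, ← hβ0] at this; linarith
  have a2 := hα.dist_eq_sub le_rfl hu hua
  have a3 := hα.dist_eq_sub hu hua le_rfl
  have b2 := hβ.dist_eq_sub le_rfl hu hub
  have b3 := hβ.dist_eq_sub hu hub le_rfl
  rw [hα0, dist_comm] at a1 a2
  rw [hβ0, dist_comm] at b1 b2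
  have h1 : u ≤ gromovProd p (α u) (α a) := by unfold gromovProd; linarith
  have h2 : u ≤ gromovProd p (β b) (β u) := by
    rw [gromovProd_comm]; unfold gromovProd; linarith
  have h3 : u ≤ gromovProd p (α a) (β u) :=
    (le_min hup h2).trans (hT.min_le_gromovProd _ _ _ _)
  have h4 : u ≤ gromovProd p (α u) (β u) :=
    (le_min h1 h3).trans (hT.min_le_gromovProd _ _ _ _)
  refine dist_le_zero.1 ?_
  unfold gromovProd at h4; linarith

/-- Points in the same component of the complement of `p` have positive Gromov product at `p`. -/
theorem ZeroHyp.gromovProd_pos (hT : ZeroHyp T) {p : T} {x y : {y : T // y ≠ p}}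
    (h : (x : ConnectedComponents {y : T // y ≠ p}) = y) :
    0 < gromovProd p (x : T) (y : T) := by
  have hcont : Continuous fun q : {y : T // y ≠ p} × {y : T // y ≠ p} =>
      gromovProd p (q.1 : T) (q.2 : T) := by
    unfold gromovProd; fun_prop
  have hself (z : {y : T // y ≠ p}) : 0 < gromovProd p (z : T) (z : T) := by
    have := dist_pos.2 z.2
    unfold gromovProd; rw [dist_self]; linarith
  have htrans {u v w : {y : T // y ≠ p}} (h1 : 0 < gromovProd p (u : T) (v : T))
      (h2 : 0 < gromovProd p (v : T) (w : T)) : 0 < gromovProd p (u : T) (w : T) :=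
    (lt_min h1 h2).trans_le (hT.min_le_gromovProd _ _ _ _)
  let U : Set {y : T // y ≠ p} := {z | 0 < gromovProd p (x : T) (z : T)}
  have hopen (z : {y : T // y ≠ p}) : IsOpen {w : {y : T // y ≠ p} | 0 < gromovProd p (z : T) (w : T)} :=
    isOpen_lt continuous_const (hcont.comp (Continuous.prodMk_right z))
  have hU : IsClopen U := by
    refine ⟨⟨isOpen_iff_mem_nhds.2 fun z hz => ?_⟩, hopen x⟩
    refine Filter.mem_of_superset ((hopen z).mem_nhds (hself z)) fun w hw hxw => hz ?_
    refine htrans hxw ?_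
    rw [gromovProd_comm]; exact hw
  have hy : y ∈ connectedComponent x := by
    rw [ConnectedComponents.coe_eq_coe.1 h]; exact mem_connectedComponent
  exact hU.connectedComponent_subset (hself x) hy

end Tree

section Action

variable {T : Type} {G : Type} [Group G] [MulAction G T]

theorem zpow_smul_eq_of_translation {c : ℝ → T} {a : G} {τ : ℝ}
    (ha : ∀ u, a • c u = c (u + τ)) (n : ℤ) (u : ℝ) : a ^ n • c u = c (u + n * τ) := by
  induction n using Int.induction_on with
  | zero => simp
  | succ k ih =>
    rw [add_comm, zpow_add, zpow_one, mul_smul, ih, ha]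
    congr 1; push_cast; ring
  | pred k ih =>
    rw [sub_eq_neg_add, zpow_add, zpow_neg_one, mul_smul, ih, inv_smul_eq_iff, ha]
    congr 1; push_cast; ring

theorem inv_smul_ne_of_ne {g : G} {p x y : T} (hg : g • p = x) (hxy : x ≠ y) : g⁻¹ • y ≠ p := by
  rw [Ne, inv_smul_eq_iff, hg]
  exact hxy.symm

variable [MetricSpace T] [IsIsometricSMul G T]

theorem IsGeodesicOn.smul {f : ℝ → T} {a b : ℝ} (hf : IsGeodesicOn f a b) (g : G) :
    IsGeodesicOn (fun u => g • f u) a b :=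
  fun s hs t ht => by rw [dist_smul, hf s hs t ht]

/-- An element translating a segment along itself has an axis through this segment. -/
theorem exists_axis (hT : ZeroHyp T) {γ : ℝ → T} {h : G} {τ : ℝ} (hτ : 0 < τ)
    (hγ : IsGeodesicOn γ 0 (2 * τ)) (hh : ∀ u, 0 ≤ u → u ≤ τ → h • γ u = γ (u + τ)) :
    ∃ c : ℝ → T, Isometry c ∧ (∀ u, h • c u = c (u + τ)) ∧
      ∀ u, 0 ≤ u → u ≤ 2 * τ → c u = γ u := by
  let c : ℝ → T := fun u => h ^ (toIcoDiv hτ 0 u) • γ (toIcoMod hτ 0 u)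
  have hc (u : ℝ) : h • c u = c (u + τ) := by
    simp only [c, toIcoDiv_add_right, toIcoMod_add_right]
    rw [add_comm, zpow_add, zpow_one, mul_smul]
  have hc0 (u : ℝ) (h0 : 0 ≤ u) (h1 : u < τ) : c u = γ u := by
    have hu : u ∈ Set.Ico (0 : ℝ) (0 + τ) := ⟨h0, by simpa using h1⟩
    have hm := (toIcoMod_eq_self hτ).2 hu
    have hd : toIcoDiv hτ 0 u = 0 :=
      toIcoDiv_eq_of_sub_zsmul_mem_Ico hτ (by simpa using hu)
    simp only [c, hm, hd, zpow_zero, one_smul]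
  have hc1 (u : ℝ) (h0 : τ ≤ u) (h1 : u < 2 * τ) : c u = γ u := by
    rw [← sub_add_cancel u τ, ← hc, hc0 _ (by linarith) (by linarith),
      hh _ (by linarith) (by linarith)]
  have hc2 (u : ℝ) (h0 : 0 ≤ u) (h1 : u ≤ 2 * τ) : c u = γ u := by
    rcases lt_or_ge u τ with h2 | h2
    · exact hc0 u h0 h2
    rcases h1.lt_or_eq with h3 | h3
    · exact hc1 u h2 h3
    · rw [← sub_add_cancel u τ, ← hc, hc1 _ (by linarith) (by linarith),
        hh _ (by linarith) (by linarith)]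
  have hgeo (n : ℤ) : IsGeodesicOn c (n * τ) ((n + 2) * τ) := by
    refine isGeodesicOn_of_le fun s t hs hst ht => ?_
    have hs' : c s = h ^ n • γ (s - n * τ) := by
      rw [← hc2 _ (by linarith) (by linarith), zpow_smul_eq_of_translation hc, sub_add_cancel]
    have ht' : c t = h ^ n • γ (t - n * τ) := by
      rw [← hc2 _ (by linarith) (by linarith), zpow_smul_eq_of_translation hc, sub_add_cancel]
    rw [hs', ht', dist_smul, hγ.dist_eq_sub (by linarith) (by linarith) (by linarith)]
    ring
  have hgeo' (n : ℤ) (k : ℕ) : IsGeodesicOn c (n * τ) ((n + k + 2) * τ) := by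
    induction k with
    | zero => simpa using hgeo n
    | succ k ih =>
      have h2 := hgeo (n + k + 1)
      push_cast at h2 ⊢
      have h3 : (0 : ℝ) ≤ k * τ := by positivity
      have := ih.glue hT h2 (by linarith) (by linarith)
      convert this using 1
      ring
  refine ⟨c, Isometry.of_dist_eq fun s t => ?_, hc, hc2⟩
  obtain ⟨N, hN⟩ := exists_nat_ge (max |s| |t| / τ)
  rw [div_le_iff₀ hτ] at hN
  have hs := abs_le.1 ((le_max_left _ _).trans hN)
  have ht := abs_le.1 ((le_max_right _ _).trans hN)
  have h1 := hgeo' (-N) (2 * N)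
  push_cast at h1
  exact h1 s ⟨by linarith, by linarith⟩ t ⟨by linarith, by linarith⟩

/-- If a free action contains a translation `a` along a line, then an element moving a fundamental
segment of `a` to another such segment of the line translates the whole line. -/
theorem smul_eq_of_translation (hT : ZeroHyp T) (hfree : ∀ (g : G) (x : T), g • x = x → g = 1)
    {c : ℝ → T} (hc : Isometry c) {a h : G} {τ s t : ℝ} (hτ : 0 < τ)
    (ha : ∀ u, a • c u = c (u + τ)) (hs : h • c s = c t) (hsτ : h • c (s + τ) = c (t + τ))
    (u : ℝ) : h • c u = c (u + (t - s)) := by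
  have hcomm : Commute h a := by
    have h1 : (a * h)⁻¹ * (h * a) = 1 := by
      refine hfree _ (c s) ?_
      rw [mul_smul, inv_smul_eq_iff, mul_smul, mul_smul, ha, hs, hsτ, ha]
    exact (inv_mul_eq_one.1 h1).symm
  have hn (n : ℤ) : h • c (s + n * τ) = c (s + n * τ + (t - s)) := by
    rw [← zpow_smul_eq_of_translation ha, ← mul_smul, (hcomm.zpow_right n).eq, mul_smul, hs,
      zpow_smul_eq_of_translation ha]
    congr 1; ring
  obtain ⟨N, hN⟩ := exists_nat_ge (|u - s| / τ)
  rw [div_le_iff₀ hτ] at hN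
  have hu := abs_le.1 hN
  have hc' : Isometry fun u => c (u + (t - s)) := hc.comp (isometry_add_right _)
  have h1 := hn (-N)
  have h2 := hn N
  push_cast at h1 h2
  exact ((hc.isGeodesicOn (s + -N * τ) (s + N * τ)).smul h).eq_of_endpoints hT
    (hc'.isGeodesicOn _ _) h1 h2 (by linarith) (by linarith)

theorem IsGeodesicOn.smul_comp_add {f : ℝ → T} {a b s : ℝ} (hf : IsGeodesicOn f a b) (g : G)
    (hs : a ≤ s) : IsGeodesicOn (fun u => g • f (s + u)) 0 (b - s) :=
  isGeodesicOn_of_le fun u v hu huv hv => by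
    rw [dist_smul, hf.dist_eq_sub (by linarith) (by linarith) (by linarith)]; ring

/-- Transporting the germs of a geodesic at two of its points to a common base point, the
resulting geodesics agree up to the Gromov product of their endpoints. -/
theorem IsGeodesicOn.smul_eq_of_le_gromovProd (hT : ZeroHyp T) {f : ℝ → T}
    {a b s s' t t' u : ℝ} (hfs : IsGeodesicOn f a b) {p : T} {g k : G} (has : a ≤ s)
    (hs : s ≤ s') (hs' : s' ≤ b) (hat : a ≤ t) (ht : t ≤ t') (ht' : t' ≤ b)
    (hg : g • p = f s) (hk : k • p = f t) (hu : 0 ≤ u)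
    (hup : u ≤ gromovProd p (g⁻¹ • f s') (k⁻¹ • f t')) :
    (k * g⁻¹) • f (s + u) = f (t + u) := by
  have h1 : IsGeodesicOn f a s' := fun x hx y hy =>
    hfs x ⟨hx.1, hx.2.trans hs'⟩ y ⟨hy.1, hy.2.trans hs'⟩
  have h2 : IsGeodesicOn f a t' := fun x hx y hy =>
    hfs x ⟨hx.1, hx.2.trans ht'⟩ y ⟨hy.1, hy.2.trans ht'⟩
  have h3 := (h1.smul_comp_add g⁻¹ has).eq_of_le_gromovProd hT (h2.smul_comp_add k⁻¹ hat)
    (sub_nonneg.2 hs) (sub_nonneg.2 ht) (p := p) (by simp [← hg]) (by simp [← hk]) hu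
    (by simpa using hup)
  rw [mul_smul]
  exact (congrArg (k • ·) h3).trans (smul_inv_smul _ _)

/-- A line with arbitrarily short translations has at most as many orbits as there are
directions at a point. -/
theorem card_stabOrbitSpace_le (hT : ZeroHyp T)
    (hfree : ∀ (g : G) (x : T), g • x = x → g = 1)
    (htrans : ∀ x y : T, ∃ g : G, g • x = y) {c : ℝ → T} (hc : Isometry c)
    (hdense : ∀ η > 0, ∃ (a : G) (τ : ℝ), 0 < τ ∧ τ ≤ η ∧ ∀ u, a • c u = c (u + τ)) (p : T) :
    #(stabOrbitSpace (fun (g : G) (x : T) => g • x) (Set.range c)) ≤ valence T p := by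
  choose g hg using fun t : ℝ => htrans p (c t)
  let y (t : ℝ) : {y : T // y ≠ p} :=
    ⟨(g t)⁻¹ • c (t + 1), inv_smul_ne_of_ne (hg t) (hc.injective.ne (by simp))⟩
  have key (s t : ℝ) (h : (y s : ConnectedComponents {y : T // y ≠ p}) = y t) :
      ∃ k ∈ setStab (fun (g : G) (x : T) => g • x) (Set.range c), k • c s = c t := by
    have hpos := hT.gromovProd_pos h
    obtain ⟨a, τ, hτ, hτ', ha⟩ := hdense _ hpos
    have hk (u : ℝ) (hu : 0 ≤ u) (hu' : u ≤ gromovProd p (y s : T) (y t : T)) :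
        (g t * (g s)⁻¹) • c (s + u) = c (t + u) :=
      (hc.isGeodesicOn (min s t) (max s t + 1)).smul_eq_of_le_gromovProd hT (min_le_left _ _)
        (by linarith) (by gcongr; exact le_max_left _ _) (min_le_right _ _) (by linarith)
        (by gcongr; exact le_max_right _ _) (hg s) (hg t) hu hu'
    have h0 := hk 0 le_rfl hpos.le
    simp only [add_zero] at h0
    have hall := smul_eq_of_translation hT hfree hc hτ ha h0 (hk τ hτ.le hτ')
    refine ⟨g t * (g s)⁻¹, ?_, h0⟩
    refine Set.Subset.antisymm ?_ ?_
    · rintro _ ⟨_, ⟨u, rfl⟩, rfl⟩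
      exact ⟨_, (hall u).symm⟩
    · rintro _ ⟨u, rfl⟩
      exact ⟨_, ⟨u - (t - s), rfl⟩, (hall _).trans (by rw [sub_add_cancel])⟩
  have hstab_mul {k l : G} (hk : k ∈ setStab (fun (g : G) (x : T) => g • x) (Set.range c))
      (hl : l ∈ setStab (fun (g : G) (x : T) => g • x) (Set.range c)) :
      k * l ∈ setStab (fun (g : G) (x : T) => g • x) (Set.range c) := by
    change (fun x => (k * l) • x) '' Set.range c = Set.range c
    simp only [mul_smul]
    rw [← Set.image_image (fun x => k • x) (fun x => l • x), hl, hk]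
  choose! z hz hzC using fun (C : Set T) (hC : C ∈ stabOrbitSpace
    (fun (g : G) (x : T) => g • x) (Set.range c)) => hC
  choose! r hr using hz
  have hsub {C C' : Set T} (hC : C ∈ stabOrbitSpace (fun (g : G) (x : T) => g • x) (Set.range c))
      (hC' : C' ∈ stabOrbitSpace (fun (g : G) (x : T) => g • x) (Set.range c))
      (h : (y (r C) : ConnectedComponents {y : T // y ≠ p}) = y (r C')) : C' ⊆ C := by
    obtain ⟨k, hk, hkz⟩ := key _ _ h
    rw [hr C hC, hr C' hC'] at hkz
    rw [hzC C hC, hzC C' hC']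
    rintro _ ⟨l, hl, rfl⟩
    exact ⟨l * k, hstab_mul hl hk, (mul_smul l k _).trans (congrArg (l • ·) hkz)⟩
  refine Cardinal.mk_le_of_injective
    (f := fun C => (y (r C.1) : ConnectedComponents {y : T // y ≠ p})) fun C C' h => ?_
  exact Subtype.ext (Set.Subset.antisymm (hsub C'.2 C.2 h.symm) (hsub C.2 C'.2 h))

/-- If there are fewer directions at a point than points in a segment, some line has arbitrarily
short translations. -/
theorem exists_line_of_valence_lt (hT : IsRTree T) (hpt : ∃ x y : T, x ≠ y)
    (hfree : ∀ (g : G) (x : T), g • x = x → g = 1)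
    (htrans : ∀ x y : T, ∃ g : G, g • x = y) {p : T} (hp : valence T p < continuum) :
    ∃ c : ℝ → T, Isometry c ∧
      ∀ η > 0, ∃ (a : G) (τ : ℝ), 0 < τ ∧ τ ≤ η ∧ ∀ u, a • c u = c (u + τ) := by
  obtain ⟨x₀, x₁, hne⟩ := hpt
  obtain ⟨γ, -, -, hγ⟩ := hT.1 x₀ x₁
  have hℓ := dist_pos.2 hne
  set ℓ := dist x₀ x₁
  change IsGeodesicOn γ 0 ℓ at hγ
  choose g hg using fun t : ℝ => htrans p (γ t)
  let y (t : Set.Ico (0 : ℝ) ℓ) : {y : T // y ≠ p} :=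
    ⟨(g t)⁻¹ • γ ℓ, inv_smul_ne_of_ne (hg t) (by
      have := hγ.dist_eq_sub t.2.1 t.2.2.le le_rfl
      rw [← dist_pos, this]
      exact sub_pos.2 t.2.2)⟩
  let dir (t : Set.Ico (0 : ℝ) ℓ) : ConnectedComponents {y : T // y ≠ p} := y t
  have hne' : Nonempty (Set.Ico (0 : ℝ) ℓ) := ⟨⟨0, le_rfl, hℓ⟩⟩
  let rep := Function.invFun dir
  have hrep (t : Set.Ico (0 : ℝ) ℓ) : dir (rep (dir t)) = dir t := Function.invFun_eq ⟨t, rfl⟩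
  have hpos (t : Set.Ico (0 : ℝ) ℓ) : 0 < gromovProd p (y t : T) (y (rep (dir t)) : T) :=
    hT.2.gromovProd_pos (hrep t).symm
  choose n hn using fun t => exists_nat_one_div_lt (hpos t)
  have hcard : #(ConnectedComponents {y : T // y ≠ p} × ℕ) < #(Set.Ico (0 : ℝ) ℓ) := by
    rw [Cardinal.mk_Ico_real hℓ, Cardinal.mk_prod, Cardinal.lift_id, Cardinal.lift_id]
    refine Cardinal.mul_lt_of_lt Cardinal.aleph0_le_continuum hp ?_
    rw [Cardinal.mk_nat]
    exact Cardinal.aleph0_lt_continuum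
  have : Infinite (Set.Ico (0 : ℝ) ℓ) := Set.infinite_coe_iff.2 (Set.Ico_infinite hℓ)
  obtain ⟨⟨d, m⟩, hinf⟩ := Cardinal.exists_infinite_fiber (fun t => (dir t, n t)) hcard
  let S : Set ℝ := Subtype.val '' ((fun t => (dir t, n t)) ⁻¹' {(d, m)})
  have hSinf : S.Infinite :=
    (Set.infinite_coe_iff.1 hinf).image Subtype.val_injective.injOn
  have hSsub : S ⊆ Set.Icc 0 ℓ := by
    rintro _ ⟨t, -, rfl⟩
    exact ⟨t.2.1, t.2.2.le⟩
  obtain ⟨ε, hε, hS⟩ : ∃ ε > 0, ∀ s ∈ S, ∀ t ∈ S, s + ε ≤ ℓ ∧ ∀ u, 0 ≤ u → u ≤ ε →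
      (g t * (g s)⁻¹) • γ (s + u) = γ (t + u) := by
    refine ⟨1 / ((m : ℝ) + 1), by positivity, ?_⟩
    rintro _ ⟨s, hs, rfl⟩ _ ⟨t, ht, rfl⟩
    simp only [Set.mem_preimage, Set.mem_singleton_iff, Prod.mk.injEq] at hs ht
    have hs1 := hn s
    have ht1 := hn t
    rw [hs.1, hs.2] at hs1
    rw [ht.1, ht.2, gromovProd_comm] at ht1
    have hst : 1 / ((m : ℝ) + 1) ≤ gromovProd p (y s : T) (y t : T) :=
      (lt_min hs1 ht1).le.trans (hT.2.min_le_gromovProd _ _ _ _)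
    refine ⟨?_, fun u hu hu' => hγ.smul_eq_of_le_gromovProd hT.2 s.2.1 s.2.2.le le_rfl t.2.1
      t.2.2.le le_rfl (hg s) (hg t) hu (hu'.trans hst)⟩
    have h1 := hst.trans (gromovProd_le_left _ _ _)
    have h2 : dist ((y s : T)) p = ℓ - s := by
      rw [← hγ.dist_eq_sub s.2.1 s.2.2.le le_rfl, ← hg s, ← dist_smul (g s) _ p, dist_comm]
      simp only [y, smul_inv_smul]
    linarith
  obtain ⟨q, -, hq⟩ := hSinf.exists_accPt_of_subset_isCompact isCompact_Icc hSsub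
  have hpair (η : ℝ) (hη : 0 < η) :
      ∃ s ∈ S, ∃ t ∈ S, s < t ∧ |s - q| < η ∧ |t - q| < η := by
    rw [accPt_iff_nhds] at hq
    obtain ⟨s, ⟨hs, hsS⟩, hsq⟩ := hq _ (Metric.ball_mem_nhds q hη)
    obtain ⟨t, ⟨ht, htS⟩, -⟩ := hq _ (Metric.ball_mem_nhds q (dist_pos.2 hsq))
    rw [Metric.mem_ball, Real.dist_eq] at hs ht
    rw [Real.dist_eq] at ht
    have hst : s ≠ t := by rintro rfl; exact lt_irrefl _ ht
    rcases hst.lt_or_gt with h | h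
    · exact ⟨s, hsS, t, htS, h, hs, ht.trans hs⟩
    · exact ⟨t, htS, s, hsS, h, ht.trans hs, hs⟩
  have htransl (s : ℝ) (hs : s ∈ S) (t : ℝ) (ht : t ∈ S) (hsq : |s - q| < ε / 8) (u : ℝ)
      (hu : 0 ≤ u) (hu' : u ≤ ε / 4) :
      (g t * (g s)⁻¹) • γ (q + ε / 8 + u) = γ (q + ε / 8 + (u + (t - s))) := by
    rw [abs_lt] at hsq
    have := (hS s hs t ht).2 (q + ε / 8 + u - s) (by linarith) (by linarith)
    rw [add_sub_cancel] at this
    rw [this]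
    congr 1; ring
  obtain ⟨s₀, hs₀, t₀, ht₀, hlt₀, hsq₀, htq₀⟩ := hpair (ε / 8) (by positivity)
  have hτ₀ : 0 < t₀ - s₀ := sub_pos.2 hlt₀
  have hτ₀' : t₀ - s₀ ≤ ε / 4 := by
    rw [abs_lt] at hsq₀ htq₀; linarith
  have hgeo : IsGeodesicOn (fun u => γ (q + ε / 8 + u)) 0 (2 * (t₀ - s₀)) := by
    have h1 := hSsub hs₀
    have h2 := (hS s₀ hs₀ t₀ ht₀).1
    rw [abs_lt] at hsq₀
    refine isGeodesicOn_of_le fun u v hu huv hv => ?_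
    rw [hγ.dist_eq_sub (by linarith [h1.1]) (by linarith) (by linarith)]
    ring
  obtain ⟨c, hc, hca, hcγ⟩ := exists_axis hT.2 hτ₀ hgeo fun u hu hu' =>
    htransl s₀ hs₀ t₀ ht₀ hsq₀ u hu (hu'.trans hτ₀')
  refine ⟨c, hc, fun η hη => ?_⟩
  obtain ⟨s, hs, t, ht, hlt, hsq, htq⟩ :=
    hpair (min (ε / 8) (min (η / 2) ((t₀ - s₀) / 2))) (by positivity)
  simp only [lt_min_iff] at hsq htq
  have hτ (δ : ℝ) (h1 : |s - q| < δ / 2) (h2 : |t - q| < δ / 2) : t - s ≤ δ := by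
    rw [abs_lt] at h1 h2; linarith
  have hle := hτ _ hsq.2.2 htq.2.2
  have h0 := htransl s hs t ht hsq.1 0 le_rfl (by positivity)
  have h1 := htransl s hs t ht hsq.1 _ hτ₀.le hτ₀'
  rw [zero_add] at h0
  rw [← hcγ 0 le_rfl (by linarith), ← hcγ (t - s) (by linarith) (by linarith)] at h0
  rw [← hcγ (t₀ - s₀) hτ₀.le (by linarith), ← hcγ _ (by linarith) (by linarith),
    add_comm (t₀ - s₀)] at h1
  refine ⟨g t * (g s)⁻¹, t - s, sub_pos.2 hlt, hτ _ hsq.2.1 htq.2.1, fun u => ?_⟩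
  simpa using smul_eq_of_translation hT.2 hfree hc hτ₀ hca h0 (by simpa using h1) u

end Action

/-- If a group acts freely and transitively by isometries on an ℝ-tree `T` (not a single
point) and every line has at least `κ ≤ 2^ℵ₀` orbits of its stabiliser action, then every
point of `T` has valence at least `κ`. -/
theorem stmt18 (κ : Cardinal) (hκ : κ ≤ Cardinal.continuum)
    (T : Type) [MetricSpace T] (hT : IsRTree T) (hpt : ∃ x y : T, x ≠ y)
    (G : Type) [Group G] (φ : G → T → T)
    (hact : IsometricAction φ) (hfree : FreeAction φ) (htrans : TransAction φ)
    (horb : ∀ L : Set T, IsLine L → κ ≤ #(stabOrbitSpace φ L)) :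
    ∀ x : T, κ ≤ valence T x := by
  intro p
  by_contra! hlt
  let _ : MulAction G T :=
    { smul := φ
      one_smul := hact.2.1
      mul_smul := hact.2.2 }
  have : IsIsometricSMul G T := ⟨hact.1⟩
  obtain ⟨c, hc, hdense⟩ :=
    exists_line_of_valence_lt hT hpt hfree htrans (hlt.trans_le hκ)
  have hle := card_stabOrbitSpace_le hT.2 hfree htrans hc hdense p
  exact (hlt.trans_le (horb _ ⟨c, hc, rfl⟩)).not_ge hle
end
end
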